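/- Let X be a separable Banach space, let μ₀ be a Gaussian probability measure on X, and let Φ : X → ℝ be measurable such that (i) for every ε > 0 there exists M(ε) ∈ ℝ with Φ(θ) ≥ M(ε) − ε‖θ‖²_X for all θ ∈ X, and (ii) for every r > 0 there exists K(r) > 0 with Φ(θ) ≤ K(r) for all θ ∈ X with ‖θ‖_X < r. Then the normalising constant Z := ∫_X exp(−Φ(θ)) dμ₀(θ) satisfies 0 < Z < ∞. Consequently the measure μ with dμ/dμ₀ = exp(−Φ)/Z is a well-defined probability measure on X. -/

import Mathlib

open MeasureTheory
open scoped NNReal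

/-- A probability measure on a normed space is Gaussian if the pushforward under every
continuous linear functional is a (possibly degenerate) Gaussian measure on `ℝ`. -/
def IsGaussianMeasure {X : Type*} [NormedAddCommGroup X] [NormedSpace ℝ X]
    [MeasurableSpace X] (μ : Measure X) : Prop :=
  ∀ L : X →L[ℝ] ℝ, ∃ (m : ℝ) (v : ℝ≥0), μ.map L = ProbabilityTheory.gaussianReal m v

/-- For a Gaussian prior `μ₀` on a separable Banach space `X` and a measurable
potential `Φ` that is bounded below by `M(ε) − ε‖θ‖²` for every `ε > 0` and bounded
above on bounded sets, the normalising constant `Z = ∫ exp(−Φ) dμ₀` satisfies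
`0 < Z < ∞` (finiteness being integrability of `exp(−Φ)`), so the measure with
`μ₀`-density `exp(−Φ)/Z` is a well-defined probability measure. -/
theorem posterior_well_defined
    {X : Type*} [NormedAddCommGroup X] [NormedSpace ℝ X] [CompleteSpace X]
    [SecondCountableTopology X] [MeasurableSpace X] [BorelSpace X]
    (μ₀ : Measure X) [IsProbabilityMeasure μ₀] (hGauss : IsGaussianMeasure μ₀)
    (Φ : X → ℝ) (hΦ : Measurable Φ)
    (hlower : ∀ ε > (0 : ℝ), ∃ M : ℝ, ∀ θ : X, Φ θ ≥ M - ε * ‖θ‖ ^ 2)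
    (hupper : ∀ r > (0 : ℝ), ∃ K > (0 : ℝ), ∀ θ : X, ‖θ‖ < r → Φ θ ≤ K) :
    (0 < ∫ θ, Real.exp (-Φ θ) ∂μ₀) ∧
    Integrable (fun θ => Real.exp (-Φ θ)) μ₀ ∧
    IsProbabilityMeasure
      ((ENNReal.ofReal (∫ θ, Real.exp (-Φ θ) ∂μ₀))⁻¹ •
        μ₀.withDensity (fun θ => ENNReal.ofReal (Real.exp (-Φ θ)))) := by
  have hI : Integrable (fun θ => Real.exp (-Φ θ)) μ₀ := by
    haveI : ProbabilityTheory.IsGaussian μ₀ := by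
      refine ⟨fun L => ?_⟩
      obtain ⟨m, v, h⟩ := hGauss L
      rw [h]
      congr 1
      · have : ∫ x, x ∂(μ₀.map L) = m := by
          rw [h, ProbabilityTheory.integral_id_gaussianReal]
        rw [← this, integral_map (by fun_prop) (by fun_prop)]
      · have : ProbabilityTheory.variance id (μ₀.map L) = v := by
          rw [h, ProbabilityTheory.variance_id_gaussianReal]
        rw [ProbabilityTheory.variance_map (by fun_prop) (by fun_prop)] at this
        simp only [Function.id_comp] at this
        rw [this, Real.toNNReal_coe]
    obtain ⟨C, hC, hCi⟩ := ProbabilityTheory.IsGaussian.exists_integrable_exp_sq μ₀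
    obtain ⟨M, hM⟩ := hlower C hC
    refine (hCi.const_mul (Real.exp (-M))).mono' (by fun_prop) (ae_of_all _ fun θ => ?_)
    rw [Real.norm_eq_abs, Real.abs_exp, ← Real.exp_add]
    exact Real.exp_le_exp.2 (by linarith [hM θ])
  have hpos : 0 < ∫ θ, Real.exp (-Φ θ) ∂μ₀ := integral_exp_pos hI
  refine ⟨hpos, hI, ⟨?_⟩⟩
  rw [Measure.smul_apply, withDensity_apply _ MeasurableSet.univ, Measure.restrict_univ,
    ← ofReal_integral_eq_lintegral_ofReal hI (ae_of_all _ fun θ => (Real.exp_pos _).le),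
    smul_eq_mul]
  exact ENNReal.inv_mul_cancel (by simpa using hpos) ENNReal.ofReal_ne_top
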